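/- arXiv:2401.15809 — 4 statements merged into one kernel-verified Lean document; each statement's English description precedes it below -/
import Mathlib

section
/- Let M > 0, Q ∈ ℝ with Q² > M², and let e ≥ 1. Then there exists r > 0 such that (e² − 1) r⁴ + M(4 − 3e²) r³ + 2(Q²(e² − 1) − 2M²) r² + 4MQ² r − Q⁴ = 0. (Consequently, in a super-extremal Euclidean Reissner–Nordström spacetime there are circular geodesics of arbitrarily large energy e.) -/
/-- In a super-extremal Euclidean Reissner–Nordström spacetime (`Q² > M²`),
for every energy `e ≥ 1` the quartic determining circular geodesics has a positive root. -/
theorem ern_superextremal_circular_orbit (M Q e : ℝ) (hM : 0 < M)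
    (hQ : M ^ 2 < Q ^ 2) (he : 1 ≤ e) :
    ∃ r : ℝ, 0 < r ∧
      (e ^ 2 - 1) * r ^ 4 + M * (4 - 3 * e ^ 2) * r ^ 3
        + 2 * (Q ^ 2 * (e ^ 2 - 1) - 2 * M ^ 2) * r ^ 2
        + 4 * M * Q ^ 2 * r - Q ^ 4 = 0 := by
  have hs : 0 ≤ e ^ 2 - 1 := by nlinarith
  have hQ0 : 0 < Q ^ 2 := lt_of_le_of_lt (sq_nonneg M) hQ
  let f : ℝ → ℝ := fun r => (e ^ 2 - 1) * r ^ 4 + M * (4 - 3 * e ^ 2) * r ^ 3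
    + 2 * (Q ^ 2 * (e ^ 2 - 1) - 2 * M ^ 2) * r ^ 2 + 4 * M * Q ^ 2 * r - Q ^ 4
  have hcont : Continuous f := by fun_prop
  obtain ⟨R, hR⟩ : ∃ R : ℝ, M * (R - 4 * M) = Q ^ 2 :=
    ⟨4 * M + Q ^ 2 / M, by field_simp; ring⟩
  have hRM : 0 < R - 4 * M := pos_of_mul_pos_right (hR ▸ hQ0) hM.le
  have hRpos : 0 < R := by linarith
  have hf0 : f 0 < 0 := by
    simp only [f]
    nlinarith [mul_pos hQ0 hQ0]
  have hfR : 0 < f R := by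
    have hfac : f R = (e ^ 2 - 1) * (R ^ 2 * (R * (R - 3 * M) + 2 * Q ^ 2))
        + R ^ 2 * (M * (R - 4 * M)) + Q ^ 2 * (4 * (M * (R - 4 * M)) + 16 * M ^ 2 - Q ^ 2) := by
      simp only [f]
      ring
    have hR3 : 0 < R - 3 * M := by linarith
    have hrest : 0 < 4 * Q ^ 2 + 16 * M ^ 2 - Q ^ 2 := by nlinarith [sq_nonneg M]
    rw [hfac, hR]
    positivity
  obtain ⟨r, hr, hfr⟩ := intermediate_value_Ioo hRpos.le hcont.continuousOn ⟨hf0, hfR⟩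
  exact ⟨r, hr.1, hfr⟩
end

section
/- Let E, L, M, Q ∈ ℝ with L ≠ 0, let F(X) = ((1 − E²)/L²) X⁴ − (2M/L²) X³ + (Q²/L² − 1) X² + 2M X − Q², and let r̄ ∈ ℝ satisfy F(r̄) = 0. Define δ = (1 − E²)/L², γ = 2(2δ r̄ − M/L²), β = 6 r̄ (δ r̄ − M/L²) + Q²/L² − 1, α = 2(2δ r̄³ − (3M/L²) r̄² + (Q²/L² − 1) r̄ + M), and g₂ = (1/4)(β²/3 − αγ), g₃ = (1/8)(αβγ/6 − α²δ/2 − β³/27). Let I ⊆ ℝ be an open interval and r : I → ℝ a differentiable function with r(φ) ≠ r̄ and r′(φ)² = F(r(φ)) for all φ ∈ I. Then the function ℘(φ) = α/(4(r(φ) − r̄)) + β/12 is differentiable on I and satisfies ℘′(φ)² = 4℘(φ)³ − g₂ ℘(φ) − g₃ for all φ ∈ I. -/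
/-- Derivative of the affine transform `α / (4 (r - rb)) + β / 12` of the shifted Binet variable. -/
theorem HasDerivAt.binet {r : ℝ → ℝ} {r' φ rb : ℝ} (α β : ℝ) (hr : HasDerivAt r r' φ)
    (hne : r φ ≠ rb) :
    HasDerivAt (fun t => α / (4 * (r t - rb)) + β / 12) (-(α * r') / (4 * (r φ - rb) ^ 2)) φ := by
  have hx : r φ - rb ≠ 0 := sub_ne_zero.mpr hne
  have h := (((hasDerivAt_const φ α).fun_div ((hr.sub_const rb).const_mul 4)
    (mul_ne_zero four_ne_zero hx)).add_const (β / 12))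
  refine h.congr_deriv ?_
  field_simp
  ring

/-- The affine Binet substitution brings a quartic vanishing at `x = 0` to Weierstrass form. -/
theorem weierstrass_of_quartic {α β γ δ x y : ℝ} (hx : x ≠ 0)
    (hy : y ^ 2 = δ * x ^ 4 + γ * x ^ 3 + β * x ^ 2 + α * x) :
    (-(α * y) / (4 * x ^ 2)) ^ 2 =
      4 * (α / (4 * x) + β / 12) ^ 3
        - 1 / 4 * (β ^ 2 / 3 - α * γ) * (α / (4 * x) + β / 12)
        - 1 / 8 * (α * β * γ / 6 - α ^ 2 * δ / 2 - β ^ 3 / 27) := by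
  rw [div_pow, neg_sq, mul_pow, hy]
  field_simp
  ring

/-- Reduction of the ERN polar radial equation `(dr/dφ)² = F(r)` to
Weierstrass form: with `℘(φ) = α/(4(r(φ) − r̄)) + β/12` one has
`℘′² = 4℘³ − g₂℘ − g₃` on the interval. -/
theorem ern_weierstrass_form (E L M Q rb : ℝ) (hL : L ≠ 0)
    (δ γ β α g₂ g₃ : ℝ)
    (hδ : δ = (1 - E ^ 2) / L ^ 2)
    (hγ : γ = 2 * (2 * δ * rb - M / L ^ 2))
    (hβ : β = 6 * rb * (δ * rb - M / L ^ 2) + Q ^ 2 / L ^ 2 - 1)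
    (hα : α = 2 * (2 * δ * rb ^ 3 - 3 * M / L ^ 2 * rb ^ 2 + (Q ^ 2 / L ^ 2 - 1) * rb + M))
    (hg₂ : g₂ = 1 / 4 * (β ^ 2 / 3 - α * γ))
    (hg₃ : g₃ = 1 / 8 * (α * β * γ / 6 - α ^ 2 * δ / 2 - β ^ 3 / 27))
    (hroot : (1 - E ^ 2) / L ^ 2 * rb ^ 4 - 2 * M / L ^ 2 * rb ^ 3
      + (Q ^ 2 / L ^ 2 - 1) * rb ^ 2 + 2 * M * rb - Q ^ 2 = 0)
    (a b : ℝ) (r : ℝ → ℝ)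
    (hne : ∀ φ ∈ Set.Ioo a b, r φ ≠ rb)
    (hdiff : ∀ φ ∈ Set.Ioo a b, DifferentiableAt ℝ r φ)
    (heq : ∀ φ ∈ Set.Ioo a b, (deriv r φ) ^ 2 =
      (1 - E ^ 2) / L ^ 2 * (r φ) ^ 4 - 2 * M / L ^ 2 * (r φ) ^ 3
        + (Q ^ 2 / L ^ 2 - 1) * (r φ) ^ 2 + 2 * M * (r φ) - Q ^ 2) :
    (∀ φ ∈ Set.Ioo a b,
      DifferentiableAt ℝ (fun t => α / (4 * (r t - rb)) + β / 12) φ) ∧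
    (∀ φ ∈ Set.Ioo a b,
      (deriv (fun t => α / (4 * (r t - rb)) + β / 12) φ) ^ 2 =
        4 * (α / (4 * (r φ - rb)) + β / 12) ^ 3
          - g₂ * (α / (4 * (r φ - rb)) + β / 12) - g₃) := by
  have hderiv : ∀ φ ∈ Set.Ioo a b, HasDerivAt (fun t => α / (4 * (r t - rb)) + β / 12)
      (-(α * deriv r φ) / (4 * (r φ - rb) ^ 2)) φ :=
    fun φ hφ => (hdiff φ hφ).hasDerivAt.binet α β (hne φ hφ)
  refine ⟨fun φ hφ => (hderiv φ hφ).differentiableAt, fun φ hφ => ?_⟩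
  rw [(hderiv φ hφ).deriv, hg₂, hg₃]
  refine weierstrass_of_quartic (sub_ne_zero.mpr (hne φ hφ)) ?_
  rw [heq φ hφ, hγ, hβ, hα, hδ]
  linear_combination hroot
end

section
/- Let ℓ < 0 and m, q, u₀, u̇₀ ∈ ℝ, set κ = √(−ℓ) and Δ(x) = x² − 2mx + q², and define u : ℝ → ℝ by u(s) = m + (u₀ − m) cosh(κ s) + u̇₀ sinh(κ s)/κ. Then u(0) = u₀, u′(0) = u̇₀, and u′(s)² = ℓ (Δ(u₀) − Δ(u(s))) + u̇₀² for all s ∈ ℝ. Moreover u is bounded on ℝ if and only if u₀ = m and u̇₀ = 0, in which case u is constant equal to m. -/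
theorem eq_zero_of_forall_mul_sinh_le {c K : ℝ} (h : ∀ t : ℝ, c * Real.sinh t ≤ K) : c = 0 := by
  by_contra hc
  obtain ⟨t, ht⟩ := Real.sinh_surjective ((K + 1) / c)
  have h1 := h t
  rw [ht, mul_div_cancel₀ _ hc] at h1
  linarith

theorem hasDerivAt_add_mul_cosh_add_mul_sinh_div (m a b s : ℝ) {κ : ℝ} (hκ : κ ≠ 0) :
    HasDerivAt (fun s => m + a * Real.cosh (κ * s) + b * Real.sinh (κ * s) / κ)
      (a * κ * Real.sinh (κ * s) + b * Real.cosh (κ * s)) s := by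
  have hlin : HasDerivAt (fun s : ℝ => κ * s) κ s := by
    simpa using (hasDerivAt_id s).const_mul κ
  refine (((hlin.cosh.const_mul a).const_add m).add
    ((hlin.sinh.const_mul b).div_const κ)).congr_deriv ?_
  field_simp

theorem bounded_add_mul_cosh_add_mul_sinh_div_iff (m a b : ℝ) {κ : ℝ} (hκ : κ ≠ 0) :
    (∃ C : ℝ, ∀ s : ℝ, |m + a * Real.cosh (κ * s) + b * Real.sinh (κ * s) / κ| ≤ C) ↔
      a = 0 ∧ b = 0 := by
  constructor
  · rintro ⟨C, hC⟩
    have key (t : ℝ) : |m + a * Real.cosh t + b / κ * Real.sinh t| ≤ C ∧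
        |m + a * Real.cosh t - b / κ * Real.sinh t| ≤ C := by
      have h1 := hC (t / κ)
      have h2 := hC (-t / κ)
      rw [mul_div_cancel₀ _ hκ] at h1 h2
      rw [Real.cosh_neg, Real.sinh_neg] at h2
      constructor
      · convert h1 using 2
        ring
      · convert h2 using 2
        ring
    have hb : b / κ = 0 := eq_zero_of_forall_mul_sinh_le (K := C) fun t => by
      obtain ⟨h1, h2⟩ := key t
      linarith [abs_le.mp h1, abs_le.mp h2]
    have ha : |a| = 0 := eq_zero_of_forall_mul_sinh_le (K := C + |m|) fun t => by
      have h1 := (key t).1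
      rw [hb, zero_mul, add_zero] at h1
      have h2 : |a| * Real.cosh t = |a * Real.cosh t| := by
        rw [abs_mul, abs_of_pos (Real.cosh_pos t)]
      have h3 : |a * Real.cosh t| ≤ |m + a * Real.cosh t| + |m| := by
        simpa using abs_sub (m + a * Real.cosh t) m
      have h4 : |a| * Real.sinh t ≤ |a| * Real.cosh t :=
        mul_le_mul_of_nonneg_left (Real.sinh_lt_cosh t).le (abs_nonneg a)
      linarith
    exact ⟨abs_eq_zero.mp ha, (div_eq_zero_iff.mp hb).resolve_right hκ⟩
  · rintro ⟨rfl, rfl⟩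
    exact ⟨|m|, fun s => by simp⟩


/-- For `ℓ < 0`, `κ = √(−ℓ)`, the hyperbolic function
`u(s) = m + (u₀ − m)cosh(κs) + u̇₀ sinh(κs)/κ` satisfies `u(0) = u₀`, `u′(0) = u̇₀`,
the Bertotti–Robinson radial equation `u′² = ℓ(Δ(u₀) − Δ(u)) + u̇₀²` with
`Δ(x) = x² − 2mx + q²`, and `u` is bounded iff `u₀ = m` and `u̇₀ = 0`,
in which case `u ≡ m`. -/
theorem br_radial_solution_neg (ℓ m q u₀ udot0 : ℝ) (hℓ : ℓ < 0)
    (κ : ℝ) (hκ : κ = Real.sqrt (-ℓ)) (u : ℝ → ℝ)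
    (hu : u = fun s => m + (u₀ - m) * Real.cosh (κ * s)
      + udot0 * Real.sinh (κ * s) / κ) :
    u 0 = u₀ ∧ deriv u 0 = udot0 ∧
    (∀ s : ℝ, (deriv u s) ^ 2 =
      ℓ * ((u₀ ^ 2 - 2 * m * u₀ + q ^ 2) - ((u s) ^ 2 - 2 * m * (u s) + q ^ 2))
        + udot0 ^ 2) ∧
    ((∃ Cb : ℝ, ∀ s : ℝ, |u s| ≤ Cb) ↔ (u₀ = m ∧ udot0 = 0)) ∧
    (u₀ = m → udot0 = 0 → ∀ s : ℝ, u s = m) := by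
  have hpos : 0 < κ := hκ ▸ Real.sqrt_pos.mpr (neg_pos.mpr hℓ)
  have hsq : ℓ = -κ ^ 2 := by
    rw [hκ, Real.sq_sqrt (neg_pos.mpr hℓ).le, neg_neg]
  have hd (s : ℝ) : deriv u s =
      (u₀ - m) * κ * Real.sinh (κ * s) + udot0 * Real.cosh (κ * s) := by
    rw [hu]
    exact (hasDerivAt_add_mul_cosh_add_mul_sinh_div m (u₀ - m) udot0 s hpos.ne').deriv
  refine ⟨by simp [hu], by simp [hd], fun s => ?_, ?_, ?_⟩
  · have hcosh := Real.cosh_sq (κ * s)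
    rw [hd, hu, hsq]
    field_simp
    linear_combination (udot0 ^ 2 - κ ^ 2 * (u₀ - m) ^ 2) * hcosh
  · rw [hu, bounded_add_mul_cosh_add_mul_sinh_div_iff m (u₀ - m) udot0 hpos.ne', sub_eq_zero]
  · rintro rfl rfl s
    simp [hu]
end

section
/- Let α > 0 and β ∈ ℝ. The function s ↦ β cosh(s√α) is a global solution on ℝ of the problem y′(s)² = α(y(s)² − β²), y(0) = β. Conversely, if I ⊆ ℝ is an open interval containing 0 and y : I → ℝ is a smooth non-constant function with y′(s)² = α(y(s)² − β²) for all s ∈ I and y(0) = β, then y(s) = β cosh(s√α) for all s ∈ I. -/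
/-- A function that solves `f' = k f` on an open interval containing `0` is
`s ↦ f 0 * exp (k * s)`. -/
lemma eq_mul_exp_of_hasDerivAt {a b k : ℝ} {f : ℝ → ℝ} (h0 : (0 : ℝ) ∈ Set.Ioo a b)
    (hf : ∀ s ∈ Set.Ioo a b, HasDerivAt f (k * f s) s) {s : ℝ} (hs : s ∈ Set.Ioo a b) :
    f s = f 0 * Real.exp (k * s) := by
  have hg : ∀ t ∈ Set.Ioo a b, HasDerivAt (fun t => f t * Real.exp (-(k * t))) 0 t := by
    intro t ht
    have he : HasDerivAt (fun t : ℝ => -(k * t)) (-(k * 1)) t :=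
      ((hasDerivAt_id t).const_mul k).neg
    refine ((hf t ht).mul he.exp).congr_deriv ?_
    ring
  have h := isOpen_Ioo.is_const_of_deriv_eq_zero isPreconnected_Ioo
    (fun t ht => (hg t ht).differentiableAt.differentiableWithinAt)
    (fun t ht => (hg t ht).deriv) hs h0
  simp only [mul_zero, neg_zero, Real.exp_zero, mul_one] at h
  rw [← h, mul_assoc, ← Real.exp_add]
  simp

/-- A solution of `y'' = w² y` with `y'(0) = 0` is `s ↦ y 0 * cosh (s * w)`. -/
lemma eq_mul_cosh_of_hasDerivAt {a b w : ℝ} (hw : w ≠ 0) {y v : ℝ → ℝ}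
    (h0 : (0 : ℝ) ∈ Set.Ioo a b) (hy : ∀ s ∈ Set.Ioo a b, HasDerivAt y (v s) s)
    (hv : ∀ s ∈ Set.Ioo a b, HasDerivAt v (w ^ 2 * y s) s) (hv0 : v 0 = 0)
    {s : ℝ} (hs : s ∈ Set.Ioo a b) : y s = y 0 * Real.cosh (s * w) := by
  have hp := eq_mul_exp_of_hasDerivAt (k := w) (f := fun t => v t + w * y t) h0
    (fun t ht => by
      refine ((hv t ht).add ((hy t ht).const_mul w)).congr_deriv ?_
      ring) hs
  have hq := eq_mul_exp_of_hasDerivAt (k := -w) (f := fun t => v t - w * y t) h0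
    (fun t ht => by
      refine ((hv t ht).sub ((hy t ht).const_mul w)).congr_deriv ?_
      ring) hs
  simp only [hv0] at hp hq
  rw [Real.cosh_eq, mul_comm s w, ← neg_mul]
  apply mul_left_cancel₀ hw
  linear_combination (hp - hq) / 2

/-- A non-constant `C²` solution of `y'² = α (y² - β²)` on an open interval satisfies the
differentiated equation `y'' = α y`. -/
lemma deriv_deriv_eq_of_sq_deriv_eq {α β a b : ℝ} {y v z : ℝ → ℝ}
    (hy : ∀ s ∈ Set.Ioo a b, HasDerivAt y (v s) s)
    (hv : ∀ s ∈ Set.Ioo a b, HasDerivAt v (z s) s) (hz : ContinuousOn z (Set.Ioo a b))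
    (hne : ¬ ∃ c : ℝ, ∀ s ∈ Set.Ioo a b, y s = c)
    (heq : ∀ s ∈ Set.Ioo a b, v s ^ 2 = α * (y s ^ 2 - β ^ 2))
    {s : ℝ} (hs : s ∈ Set.Ioo a b) : z s = α * y s := by
  have hprod : ∀ t ∈ Set.Ioo a b, v t * (z t - α * y t) = 0 := by
    intro t ht
    have h1 := (hv t ht).pow 2
    have h2 := (((hy t ht).pow 2).sub_const (β ^ 2)).const_mul α
    have hev : v ^ 2 =ᶠ[nhds t] fun x => α * ((y ^ 2) x - β ^ 2) :=
      Filter.mem_of_superset (isOpen_Ioo.mem_nhds ht) heq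
    have h3 := h1.unique (h2.congr_of_eventuallyEq hev)
    norm_num at h3
    linear_combination h3 / 2
  have hcont : ContinuousOn (fun t => z t - α * y t) (Set.Ioo a b) :=
    hz.sub (continuousOn_const.mul fun t ht => (hy t ht).continuousAt.continuousWithinAt)
  have hvals : ∀ t ∈ Set.Ioo a b,
      (z t - α * y t) ^ 2 ∈ ({0, (α * β) ^ 2} : Set ℝ) := by
    intro t ht
    by_cases h : z t - α * y t = 0
    · simp [h]
    right
    have hvt : v t = 0 := (mul_eq_zero.1 (hprod t ht)).resolve_right h
    have hev : v =ᶠ[nhds t] fun _ => 0 := by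
      filter_upwards [isOpen_Ioo.mem_nhds ht,
        (hcont.continuousAt (isOpen_Ioo.mem_nhds ht)).eventually_ne h] with x hx hx'
      exact (mul_eq_zero.1 (hprod x hx)).resolve_right hx'
    have hzt : z t = 0 :=
      (hv t ht).unique ((hasDerivAt_const t (0 : ℝ)).congr_of_eventuallyEq hev)
    have he := heq t ht
    rw [hvt] at he
    rw [Set.mem_singleton_iff, hzt]
    linear_combination -α * he
  by_contra hsz
  apply hne
  refine ⟨y s, fun t ht => isOpen_Ioo.is_const_of_deriv_eq_zero isPreconnected_Ioo
    (fun x hx => (hy x hx).differentiableAt.differentiableWithinAt) (fun x hx => ?_) ht hs⟩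
  have hconst : (z x - α * y x) ^ 2 = (z s - α * y s) ^ 2 :=
    isPreconnected_Ioo.constant_of_mapsTo (Set.toFinite _).isDiscrete (hcont.pow 2) hvals hx hs
  have hx0 : z x - α * y x ≠ 0 := by
    intro h
    rw [h, zero_pow two_ne_zero] at hconst
    exact hsz (sub_eq_zero.1 (pow_eq_zero_iff two_ne_zero |>.1 hconst.symm))
  rw [(hy x hx).deriv]
  exact (mul_eq_zero.1 (hprod x hx)).resolve_right hx0

/-- For `α > 0`, `β ∈ ℝ`, the function `s ↦ β cosh(s√α)` is a global
solution of `y′² = α(y² − β²)`, `y(0) = β`; conversely any smooth non-constant solution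
on an open interval containing `0` coincides with it. -/
theorem cosh_ivp (α β : ℝ) (hα : 0 < α) :
    ((fun s : ℝ => β * Real.cosh (s * Real.sqrt α)) 0 = β ∧
      ∀ s : ℝ,
        (deriv (fun s : ℝ => β * Real.cosh (s * Real.sqrt α)) s) ^ 2 =
          α * ((β * Real.cosh (s * Real.sqrt α)) ^ 2 - β ^ 2)) ∧
    ∀ (a b : ℝ) (y : ℝ → ℝ), a < 0 → 0 < b →
      ContDiffOn ℝ (⊤ : ℕ∞) y (Set.Ioo a b) →
      (¬ ∃ c : ℝ, ∀ s ∈ Set.Ioo a b, y s = c) →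
      (∀ s ∈ Set.Ioo a b, (deriv y s) ^ 2 = α * ((y s) ^ 2 - β ^ 2)) →
      y 0 = β →
      ∀ s ∈ Set.Ioo a b, y s = β * Real.cosh (s * Real.sqrt α) := by
  have hsq : Real.sqrt α ^ 2 = α := Real.sq_sqrt hα.le
  refine ⟨⟨by simp, fun s => ?_⟩, fun a b y ha hb hy hne heq hy0 s hs => ?_⟩
  · have hd : HasDerivAt (fun s : ℝ => β * Real.cosh (s * Real.sqrt α))
        (β * (Real.sinh (s * Real.sqrt α) * (1 * Real.sqrt α))) s :=
      (((hasDerivAt_id s).mul_const _).cosh).const_mul β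
    rw [hd.deriv]
    linear_combination β ^ 2 * Real.sinh (s * Real.sqrt α) ^ 2 * hsq -
      α * β ^ 2 * Real.cosh_sq (s * Real.sqrt α)
  · have h0 : (0 : ℝ) ∈ Set.Ioo a b := ⟨ha, hb⟩
    have hy' : ContDiffOn ℝ (⊤ : ℕ∞) (deriv y) (Set.Ioo a b) :=
      hy.deriv_of_isOpen isOpen_Ioo (by simp)
    have hdy : ∀ t ∈ Set.Ioo a b, HasDerivAt y (deriv y t) t := fun t ht =>
      ((hy.contDiffAt (isOpen_Ioo.mem_nhds ht)).differentiableAt (by simp)).hasDerivAt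
    have hdv : ∀ t ∈ Set.Ioo a b, HasDerivAt (deriv y) (deriv (deriv y) t) t := fun t ht =>
      ((hy'.contDiffAt (isOpen_Ioo.mem_nhds ht)).differentiableAt (by simp)).hasDerivAt
    have hz : ContinuousOn (deriv (deriv y)) (Set.Ioo a b) :=
      hy'.continuousOn_deriv_of_isOpen isOpen_Ioo (by simp)
    have hv0 : deriv y 0 = 0 := by
      have h := heq 0 h0
      rw [hy0, sub_self, mul_zero] at h
      exact pow_eq_zero_iff two_ne_zero |>.1 h
    rw [← hy0]
    refine eq_mul_cosh_of_hasDerivAt (Real.sqrt_pos.2 hα).ne' h0 hdy (fun t ht => ?_) hv0 hs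
    rw [hsq, ← deriv_deriv_eq_of_sq_deriv_eq hdy hdv hz hne heq ht]
    exact hdv t ht
end
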